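/- arXiv:1903.05422 — 3 statements merged into one kernel-verified Lean document; each statement's English description precedes it below -/
import Mathlib

section
/- Let Υ : ℕ → ℝ satisfy Υ(0) = 0 and Υ(n) > 0 for all n ≥ 1, and assume ∑_n exp(−λ₀·Υ(n)) < ∞ for some λ₀ ∈ (0,1). Set Z(λ) = ∑_n exp(−λ·Υ(n)) and ⟨Υ̂⟩(λ) = (∑_n Υ(n)·exp(−λ·Υ(n)))/Z(λ). Then the improper integral ∫₁^{+∞} ⟨Υ̂⟩(λ) dλ converges and log Z(1) = ∫₁^{+∞} ⟨Υ̂⟩(λ) dλ. (This is the spectral content of the paper's Theorem: if the local equilibrium operator is bounded from below with non-degenerate lowest eigenvector, the logarithm of the partition function is obtained by integrating over λ ∈ [1,∞) the expectation value of the shifted operator, i.e. log Z is extensive.) -/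
open Real Filter Topology MeasureTheory

/-- A linear factor is absorbed by an arbitrarily small increase of the exponential decay rate. -/
lemma mul_exp_neg_mul_le {a b x : ℝ} (hab : a < b) :
    x * Real.exp (-b * x) ≤ (b - a)⁻¹ * Real.exp (-a * x) := by
  have hba : 0 < b - a := sub_pos.mpr hab
  have hle : (b - a) * x ≤ Real.exp ((b - a) * x) := by
    linarith [Real.add_one_le_exp ((b - a) * x)]
  rw [inv_mul_eq_div, le_div_iff₀ hba]
  calc x * Real.exp (-b * x) * (b - a) = (b - a) * x * Real.exp (-b * x) := by ring
    _ ≤ Real.exp ((b - a) * x) * Real.exp (-b * x) := by gcongr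
    _ = Real.exp (-a * x) := by rw [← Real.exp_add]; ring_nf

section PartitionFunction

variable {ι : Type*} {E : ι → ℝ} {a b : ℝ}

lemma summable_exp_neg_mul_of_le (hE : ∀ n, 0 ≤ E n)
    (hsum : Summable fun n => Real.exp (-a * E n)) (hab : a ≤ b) :
    Summable fun n => Real.exp (-b * E n) :=
  hsum.of_nonneg_of_le (fun _ => (Real.exp_pos _).le) fun n =>
    Real.exp_le_exp.mpr (mul_le_mul_of_nonneg_right (neg_le_neg hab) (hE n))

lemma hasDerivAt_tsum_exp_neg_mul (hE : ∀ n, 0 ≤ E n)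
    (hsum : Summable fun n => Real.exp (-a * E n)) (hab : a < b) :
    HasDerivAt (fun t : ℝ => ∑' n, Real.exp (-t * E n))
      (-∑' n, E n * Real.exp (-b * E n)) b := by
  obtain ⟨c, hac, hcb⟩ := exists_between hab
  rw [← tsum_neg]
  refine hasDerivAt_tsum_of_isPreconnected (t := Set.Ioi c) (y₀ := b)
    (g := fun n t => Real.exp (-t * E n)) (g' := fun n t => -(E n * Real.exp (-t * E n)))
    (hsum.mul_left (c - a)⁻¹) isOpen_Ioi isPreconnected_Ioi (fun n t _ => ?_)
    (fun n t ht => ?_) hcb (summable_exp_neg_mul_of_le hE hsum hab.le) hcb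
  · have h := ((hasDerivAt_id' t).neg.mul_const (E n)).exp
    rw [neg_one_mul, mul_neg, mul_comm] at h
    exact h
  · rw [norm_neg, Real.norm_of_nonneg (mul_nonneg (hE n) (Real.exp_pos _).le)]
    refine le_trans ?_ (mul_exp_neg_mul_le hac)
    exact mul_le_mul_of_nonneg_left (Real.exp_le_exp.mpr
      (mul_le_mul_of_nonneg_right (neg_le_neg (le_of_lt ht)) (hE n))) (hE n)

lemma tsum_exp_neg_mul_pos [Nonempty ι] (hE : ∀ n, 0 ≤ E n)
    (hsum : Summable fun n => Real.exp (-a * E n)) (hab : a ≤ b) :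
    0 < ∑' n, Real.exp (-b * E n) :=
  (summable_exp_neg_mul_of_le hE hsum hab).tsum_pos (fun _ => (Real.exp_pos _).le)
    (Classical.arbitrary ι) (Real.exp_pos _)

/-- At infinite decay rate only the non-degenerate ground state contributes. -/
lemma tendsto_tsum_exp_neg_mul_atTop {i : ι} (hi : E i = 0) (hpos : ∀ n, n ≠ i → 0 < E n)
    (hsum : Summable fun n => Real.exp (-a * E n)) :
    Tendsto (fun t : ℝ => ∑' n, Real.exp (-t * E n)) atTop (𝓝 1) := by
  classical
  have hE : ∀ n, 0 ≤ E n := fun n => by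
    by_cases h : n = i
    · rw [h, hi]
    · exact (hpos n h).le
  rw [← tsum_ite_eq i (fun _ => (1 : ℝ))]
  refine tendsto_tsum_of_dominated_convergence hsum (fun n => ?_) ?_
  · by_cases h : n = i
    · simp [h, hi]
    · simp only [if_neg h]
      exact Real.tendsto_exp_atBot.comp
        (tendsto_neg_atTop_atBot.atBot_mul_const (hpos n h))
  · filter_upwards [eventually_ge_atTop a] with t ht n
    rw [Real.norm_of_nonneg (Real.exp_pos _).le]
    exact Real.exp_le_exp.mpr (mul_le_mul_of_nonneg_right (neg_le_neg ht) (hE n))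

end PartitionFunction

/-- If Υ(0) = 0 and Υ(n) > 0 for n ≥ 1, with ∑ exp(−λ₀Υ(n)) < ∞ for some
λ₀ ∈ (0,1), and Z(λ) = ∑ exp(−λΥ(n)), ⟨Υ̂⟩(λ) = (∑ Υ(n)exp(−λΥ(n)))/Z(λ), then
∫₁^∞ ⟨Υ̂⟩(λ) dλ converges and equals log Z(1): the logarithm of the partition
function is obtained by integrating the expectation value of the local
equilibrium operator, i.e. log Z is extensive. -/
theorem log_partition_function_extensive
    (Υ : ℕ → ℝ) (h0 : Υ 0 = 0) (hpos : ∀ n : ℕ, 1 ≤ n → 0 < Υ n)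
    (lam₀ : ℝ) (hlam₀ : 0 < lam₀) (hlam₀1 : lam₀ < 1)
    (hsum : Summable fun n => Real.exp (-lam₀ * Υ n)) :
    IntegrableOn
      (fun lam : ℝ =>
        (∑' n, Υ n * Real.exp (-lam * Υ n)) / (∑' n, Real.exp (-lam * Υ n)))
      (Set.Ici 1) volume ∧
    Real.log (∑' n, Real.exp (-(1 : ℝ) * Υ n)) =
      ∫ lam in Set.Ici (1 : ℝ),
        (∑' n, Υ n * Real.exp (-lam * Υ n)) / (∑' n, Real.exp (-lam * Υ n)) := by
  have hE : ∀ n, 0 ≤ Υ n := fun n => by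
    rcases Nat.eq_zero_or_pos n with rfl | h
    · exact h0.ge
    · exact (hpos n h).le
  have hderiv : ∀ t ∈ Set.Ici (1 : ℝ),
      HasDerivAt (fun lam : ℝ => -Real.log (∑' n, Real.exp (-lam * Υ n)))
        ((∑' n, Υ n * Real.exp (-t * Υ n)) / (∑' n, Real.exp (-t * Υ n))) t := fun t ht => by
    have hlt : lam₀ < t := hlam₀1.trans_le ht
    have h := ((hasDerivAt_tsum_exp_neg_mul hE hsum hlt).log
      (tsum_exp_neg_mul_pos hE hsum hlt.le).ne').neg
    rwa [neg_div, neg_neg] at h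
  have hnonneg : ∀ t ∈ Set.Ioi (1 : ℝ),
      0 ≤ (∑' n, Υ n * Real.exp (-t * Υ n)) / (∑' n, Real.exp (-t * Υ n)) := fun t _ =>
    div_nonneg (tsum_nonneg fun n => mul_nonneg (hE n) (Real.exp_pos _).le)
      (tsum_nonneg fun _ => (Real.exp_pos _).le)
  have hlim : Tendsto (fun lam : ℝ => -Real.log (∑' n, Real.exp (-lam * Υ n))) atTop (𝓝 0) := by
    have h := ((tendsto_tsum_exp_neg_mul_atTop h0
      (fun n hn => hpos n (Nat.one_le_iff_ne_zero.mpr hn)) hsum).log one_ne_zero).neg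
    rwa [Real.log_one, neg_zero] at h
  refine ⟨Iff.mpr integrableOn_Ici_iff_integrableOn_Ioi
    (integrableOn_Ioi_deriv_of_nonneg' hderiv hnonneg hlim), ?_⟩
  rw [integral_Ici_eq_integral_Ioi, integral_Ioi_of_hasDerivAt_of_nonneg' hderiv hnonneg hlim,
    zero_sub, neg_neg]
end

section
/- Fix a > 0 and T₀ > 0, write z' = z + 1/a, and let β(t,x,y,z) = (a/T₀)·(z', 0, 0, t) on the right Rindler wedge RRW = {(t,x,y,z) ∈ ℝ⁴ : z + 1/a > |t|}. Let u = β/√(Q(β)), A^μ = ∑_ν u^ν ∂u^μ/∂x^ν, and α = √(Q(β))·A. Then at every point of the RRW: Q(α) = Q(β)·Q(A) = −a²/T₀² (a constant independent of the point), and η(α, β) = 0. -/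
open Real MeasureTheory Filter Topology

noncomputable section

/-- Diagonal of the Minkowski metric diag(1,-1,-1,-1). -/
def ηd : Fin 4 → ℝ := ![1, -1, -1, -1]

/-- Minkowski quadratic form Q(v) = (v⁰)² − (v¹)² − (v²)² − (v³)². -/
def minkQ (v : Fin 4 → ℝ) : ℝ := ∑ μ, ηd μ * v μ * v μ

/-- Minkowski bilinear form η(v,w). -/
def minkB (v w : Fin 4 → ℝ) : ℝ := ∑ μ, ηd μ * v μ * w μ

/-- Covariant (lowered) components v_μ = η_{μν} v^ν. -/
def lo (v : Fin 4 → ℝ) (μ : Fin 4) : ℝ := ηd μ * v μ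

/-- Partial derivative ∂_μ of a scalar function on ℝ⁴. -/
def pd (μ : Fin 4) (f : (Fin 4 → ℝ) → ℝ) (x : Fin 4 → ℝ) : ℝ :=
  fderiv ℝ f x (Pi.single μ 1)

/-- Four-temperature field β(t,x,y,z) = (a/T₀)(z+1/a, 0, 0, t), with x = (t,x,y,z). -/
def betaF (a T₀ : ℝ) (x : Fin 4 → ℝ) : Fin 4 → ℝ :=
  fun μ => (a / T₀) * ![x 3 + 1 / a, 0, 0, x 0] μ

/-- The right Rindler wedge {z + 1/a > |t|}. -/
def RRW (a : ℝ) : Set (Fin 4 → ℝ) := {x | |x 0| < x 3 + 1 / a}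

/-- Flow velocity u = β/√(Q(β)). -/
def uF (a T₀ : ℝ) (x : Fin 4 → ℝ) : Fin 4 → ℝ :=
  fun μ => betaF a T₀ x μ / Real.sqrt (minkQ (betaF a T₀ x))

/-- Four-acceleration A^μ = u^ν ∂_ν u^μ. -/
def accF (a T₀ : ℝ) (x : Fin 4 → ℝ) : Fin 4 → ℝ :=
  fun μ => ∑ ν, uF a T₀ x ν * pd ν (fun y => uF a T₀ y μ) x

/-- Thermal acceleration α = √(Q(β))·A = A/T. -/
def alphaF (a T₀ : ℝ) (x : Fin 4 → ℝ) : Fin 4 → ℝ :=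
  fun μ => Real.sqrt (minkQ (betaF a T₀ x)) * accF a T₀ x μ

theorem minkQ_betaF (a T₀ : ℝ) (x : Fin 4 → ℝ) :
    minkQ (betaF a T₀ x) = (a / T₀) ^ 2 * ((x 3 + 1 / a) ^ 2 - x 0 ^ 2) := by
  simp [minkQ, betaF, ηd, Fin.sum_univ_four]
  ring

theorem sq_sub_sq_pos_of_mem_RRW {a : ℝ} {x : Fin 4 → ℝ} (hx : x ∈ RRW a) :
    0 < (x 3 + 1 / a) ^ 2 - x 0 ^ 2 := by
  obtain ⟨h₁, h₂⟩ : -(x 3 + 1 / a) < x 0 ∧ x 0 < x 3 + 1 / a := abs_lt.1 hx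
  exact sub_pos.2 (sq_lt_sq' h₁ h₂)

theorem minkQ_betaF_pos {a T₀ : ℝ} (ha : 0 < a) (hT₀ : 0 < T₀) {x : Fin 4 → ℝ}
    (hx : x ∈ RRW a) : 0 < minkQ (betaF a T₀ x) := by
  rw [minkQ_betaF]
  have := sq_sub_sq_pos_of_mem_RRW hx
  positivity

/-- The directional derivative is the contraction of the direction with the partial derivatives. -/
theorem sum_mul_pd (f : (Fin 4 → ℝ) → ℝ) (x v : Fin 4 → ℝ) :
    ∑ ν, v ν * pd ν f x = fderiv ℝ f x v := by
  conv_rhs => rw [pi_eq_sum_univ' v]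
  simp [pd, map_sum]

theorem differentiable_betaF_apply (a T₀ : ℝ) (μ : Fin 4) :
    Differentiable ℝ fun y => betaF a T₀ y μ := by
  fin_cases μ <;> simp [betaF] <;> fun_prop

theorem differentiableAt_uF_apply {a T₀ : ℝ} (ha : 0 < a) (hT₀ : 0 < T₀) {x : Fin 4 → ℝ}
    (hx : x ∈ RRW a) (μ : Fin 4) : DifferentiableAt ℝ (fun y => uF a T₀ y μ) x := by
  have hQ := minkQ_betaF_pos ha hT₀ hx
  have hd : DifferentiableAt ℝ (fun y => minkQ (betaF a T₀ y)) x := by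
    simp only [minkQ_betaF]
    fun_prop
  have hs := hd.sqrt hQ.ne'
  have hs0 := (Real.sqrt_pos.2 hQ).ne'
  simp only [uF, div_eq_mul_inv]
  exact (differentiable_betaF_apply a T₀ μ x).fun_mul (hs.fun_inv hs0)

/-- Closed form of the four-acceleration on the wedge: the norm of `β` is stationary along `u`, so
only the derivative of `β` contributes. -/
theorem accF_apply {a T₀ : ℝ} (ha : 0 < a) (hT₀ : 0 < T₀) {x : Fin 4 → ℝ}
    (hx : x ∈ RRW a) (μ : Fin 4) :
    accF a T₀ x μ = (a / T₀) ^ 2 * ![x 0, 0, 0, x 3 + 1 / a] μ / minkQ (betaF a T₀ x) := by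
  have hQ := minkQ_betaF_pos ha hT₀ hx
  set r := Real.sqrt (minkQ (betaF a T₀ x)) with hr
  have hr0 : 0 < r := Real.sqrt_pos.2 hQ
  have hrr : r ^ 2 = minkQ (betaF a T₀ x) := Real.sq_sqrt hQ.le
  set v := uF a T₀ x with hv
  have hv0 : v 0 = a / T₀ * (x 3 + 1 / a) / r := by simp [hv, uF, betaF, hr]
  have hv3 : v 3 = a / T₀ * x 0 / r := by simp [hv, uF, betaF, hr]
  have hl (i : Fin 4) : HasDerivAt (fun s : ℝ => (x + s • v) i) (v i) 0 := by
    simpa using ((hasDerivAt_id (0 : ℝ)).mul_const (v i)).const_add (x i)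
  have hQd : HasDerivAt (fun s : ℝ => minkQ (betaF a T₀ (x + s • v))) 0 0 := by
    simp only [minkQ_betaF]
    refine (((((hl 3).add_const (1 / a)).pow 2).sub ((hl 0).pow 2)).const_mul
      ((a / T₀) ^ 2)).congr_deriv ?_
    simp only [hv0, hv3, zero_smul, add_zero]
    ring
  have hrd : HasDerivAt (fun s : ℝ => Real.sqrt (minkQ (betaF a T₀ (x + s • v)))) 0 0 := by
    simpa using hQd.sqrt (by simpa using hQ.ne')
  have hβd : HasDerivAt (fun s : ℝ => betaF a T₀ (x + s • v) μ)
      (a / T₀ * ![v 3, 0, 0, v 0] μ) 0 := by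
    refine HasDerivAt.const_mul _ ?_
    fin_cases μ
    · exact (hl 3).add_const (1 / a)
    · exact hasDerivAt_const _ _
    · exact hasDerivAt_const _ _
    · exact hl 0
  have hud := hβd.div hrd (by simpa using hr0.ne')
  have hline : HasLineDerivAt ℝ (fun y => uF a T₀ y μ) _ x v := hud
  have hacc : accF a T₀ x μ = fderiv ℝ (fun y => uF a T₀ y μ) x v := sum_mul_pd _ _ _
  rw [hacc, ← (differentiableAt_uF_apply ha hT₀ hx μ).lineDeriv_eq_fderiv, hline.lineDeriv,
    ← hrr]
  simp only [zero_smul, add_zero, ← hr, mul_zero, sub_zero]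
  fin_cases μ <;> simp [hv0, hv3] <;> field_simp

theorem minkQ_const_mul (c : ℝ) (v : Fin 4 → ℝ) : minkQ (fun μ => c * v μ) = c ^ 2 * minkQ v := by
  simp only [minkQ, Finset.mul_sum]
  exact Finset.sum_congr rfl fun _ _ => by ring

/-- For the four-temperature β = (a/T₀)(z', 0, 0, t) on the right Rindler wedge,
the thermal acceleration α = √(Q(β))·A satisfies Q(α) = Q(β)·Q(A) = −a²/T₀²
(a constant) and η(α,β) = 0. -/
theorem thermal_acceleration_constant
    (a T₀ : ℝ) (ha : 0 < a) (hT₀ : 0 < T₀) :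
    ∀ x ∈ RRW a,
      minkQ (alphaF a T₀ x) = minkQ (betaF a T₀ x) * minkQ (accF a T₀ x) ∧
      minkQ (alphaF a T₀ x) = -(a ^ 2 / T₀ ^ 2) ∧
      minkB (alphaF a T₀ x) (betaF a T₀ x) = 0 := by
  intro x hx
  have hQ := minkQ_betaF_pos ha hT₀ hx
  have hα : minkQ (alphaF a T₀ x) = minkQ (betaF a T₀ x) * minkQ (accF a T₀ x) := by
    unfold alphaF
    rw [minkQ_const_mul, Real.sq_sqrt hQ.le]
  have hacc : minkQ (accF a T₀ x) = -((a / T₀) ^ 2 / minkQ (betaF a T₀ x)) := by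
    have hS := minkQ_betaF a T₀ x
    have hexp : minkQ (accF a T₀ x) = -((a / T₀) ^ 2 *
        ((a / T₀) ^ 2 * ((x 3 + 1 / a) ^ 2 - x 0 ^ 2)) / minkQ (betaF a T₀ x) ^ 2) := by
      simp only [minkQ.eq_1 (accF a T₀ x), accF_apply ha hT₀ hx, Fin.sum_univ_four]
      simp [ηd]
      ring
    rw [hexp, ← hS]
    field_simp
  refine ⟨hα, ?_, ?_⟩
  · rw [hα, hacc]
    field_simp
  · simp only [minkB, alphaF, accF_apply ha hT₀ hx, Fin.sum_univ_four]
    simp [ηd, betaF]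
    ring
end
end

section
/- Fix a > 0 and T₀ > 0, write z' = z + 1/a, and let β(t,x,y,z) = (a/T₀)·(z', 0, 0, t), so that β² := Q(β) = (a/T₀)²(z'² − t²) > 0 on the right Rindler wedge RRW = {z + 1/a > |t|}, and let α² = −a²/T₀². Then on the RRW the flat d'Alembertian □ = ∂_t² − ∂_x² − ∂_y² − ∂_z² applied to the function x ↦ 1/(12·β²(x)) satisfies □(1/(12β²)) = α²/(3(β²)²). -/
open Real MeasureTheory Filter Topology

noncomputable section

/-- The flat d'Alembertian □ = ∂_t² − ∂_x² − ∂_y² − ∂_z². -/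
def dAlembert (f : (Fin 4 → ℝ) → ℝ) (x : Fin 4 → ℝ) : ℝ :=
  ∑ μ, ηd μ * pd μ (fun y => pd μ f y) x

theorem isOpen_RRW (a : ℝ) : IsOpen (RRW a) :=
  isOpen_lt (by fun_prop) (by fun_prop)

theorem pd_congr {f g : (Fin 4 → ℝ) → ℝ} {x : Fin 4 → ℝ} (h : f =ᶠ[𝓝 x] g) (μ : Fin 4) :
    pd μ f x = pd μ g x := by
  rw [pd, pd, h.fderiv_eq]

theorem pd_div {f g : (Fin 4 → ℝ) → ℝ} {x : Fin 4 → ℝ} (hf : DifferentiableAt ℝ f x)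
    (hg : DifferentiableAt ℝ g x) (h0 : g x ≠ 0) (μ : Fin 4) :
    pd μ (fun y => f y / g y) x = (pd μ f x * g x - f x * pd μ g x) / g x ^ 2 := by
  simp only [div_eq_mul_inv]
  have h := hf.hasFDerivAt.fun_mul ((hasDerivAt_inv h0).comp_hasFDerivAt x hg.hasFDerivAt)
  simp only [Function.comp_def] at h
  rw [pd, HasFDerivAt.fderiv h]
  simp [pd]
  field_simp
  ring

theorem differentiable_minkQ_betaF (a T₀ : ℝ) :
    Differentiable ℝ fun y => minkQ (betaF a T₀ y) := by
  simp only [minkQ_betaF]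
  fun_prop

theorem pd_linear (b c d : ℝ) (μ : Fin 4) (x : Fin 4 → ℝ) :
    pd μ (fun y => b * y 3 + c * y 0 + d) x =
      b * (Pi.single μ 1 : Fin 4 → ℝ) 3 + c * (Pi.single μ 1 : Fin 4 → ℝ) 0 := by
  have h3 := (hasFDerivAt_apply (𝕜 := ℝ) (3 : Fin 4) x).const_mul b
  have h0 := (hasFDerivAt_apply (𝕜 := ℝ) (0 : Fin 4) x).const_mul c
  rw [pd, ((h3.fun_add h0).add_const d).fderiv]
  simp

theorem pd_minkQ_betaF (a T₀ : ℝ) (μ : Fin 4) (x : Fin 4 → ℝ) :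
    pd μ (fun y => minkQ (betaF a T₀ y)) x =
      2 * (a / T₀) ^ 2 * ((x 3 + 1 / a) * (Pi.single μ 1 : Fin 4 → ℝ) 3
        - x 0 * (Pi.single μ 1 : Fin 4 → ℝ) 0) := by
  simp only [minkQ_betaF]
  have h3 := ((hasFDerivAt_apply (𝕜 := ℝ) (3 : Fin 4) x).add_const (1 / a)).pow 2
  have h0 := (hasFDerivAt_apply (𝕜 := ℝ) (0 : Fin 4) x).pow 2
  rw [pd, HasFDerivAt.fderiv ((h3.fun_sub h0).const_mul ((a / T₀) ^ 2))]
  simp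
  ring

theorem pd_one_div_minkQ_betaF {a T₀ : ℝ} {x : Fin 4 → ℝ}
    (h : minkQ (betaF a T₀ x) ≠ 0) (μ : Fin 4) :
    pd μ (fun y => 1 / (12 * minkQ (betaF a T₀ y))) x =
      -pd μ (fun y => minkQ (betaF a T₀ y)) x / (12 * minkQ (betaF a T₀ x) ^ 2) := by
  have hd := differentiable_minkQ_betaF a T₀ x
  have e : (fun y => 1 / (12 * minkQ (betaF a T₀ y))) =
      fun y => (1 / 12) / minkQ (betaF a T₀ y) := by
    funext y
    rw [div_div]
  rw [e, pd_div (differentiableAt_const _) hd h]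
  have hc : pd μ (fun _ => (1 / 12 : ℝ)) x = 0 := by simp [pd]
  rw [hc]
  field_simp
  ring

theorem pd_pd_one_div_minkQ_betaF {a T₀ : ℝ} (ha : 0 < a) (hT₀ : 0 < T₀) {x : Fin 4 → ℝ}
    (hx : x ∈ RRW a) (μ : Fin 4) :
    pd μ (fun y => pd μ (fun z => 1 / (12 * minkQ (betaF a T₀ z))) y) x =
      (2 * pd μ (fun y => minkQ (betaF a T₀ y)) x ^ 2
        - minkQ (betaF a T₀ x) * pd μ (fun y => pd μ (fun z => minkQ (betaF a T₀ z)) y) x)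
        / (12 * minkQ (betaF a T₀ x) ^ 3) := by
  have h := (minkQ_betaF_pos ha hT₀ hx).ne'
  have e : (fun y => pd μ (fun z => 1 / (12 * minkQ (betaF a T₀ z))) y) =ᶠ[𝓝 x]
      fun y => (-(1 / 12) * pd μ (fun z => minkQ (betaF a T₀ z)) y / minkQ (betaF a T₀ y))
        / minkQ (betaF a T₀ y) := by
    filter_upwards [(isOpen_RRW a).mem_nhds hx] with y hy
    have := (minkQ_betaF_pos ha hT₀ hy).ne'
    rw [pd_one_div_minkQ_betaF this]
    field_simp
  have hd := differentiable_minkQ_betaF a T₀ x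
  have hp : DifferentiableAt ℝ (fun y => pd μ (fun z => minkQ (betaF a T₀ z)) y) x := by
    simp only [pd_minkQ_betaF]
    fun_prop
  have hm : pd μ (fun y => -(1 / 12) * pd μ (fun z => minkQ (betaF a T₀ z)) y) x =
      -(1 / 12) * pd μ (fun y => pd μ (fun z => minkQ (betaF a T₀ z)) y) x := by
    rw [pd, fderiv_const_mul hp]
    rfl
  have hcp := hp.const_mul (-(1 / 12))
  have hquot : DifferentiableAt ℝ (fun y => -(1 / 12) *
      pd μ (fun z => minkQ (betaF a T₀ z)) y / minkQ (betaF a T₀ y)) x := by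
    simpa only [div_eq_mul_inv] using hcp.fun_mul (hd.fun_inv h)
  rw [pd_congr e, pd_div hquot hd h, pd_div hcp hd h, hm]
  field_simp
  ring

theorem pd_pd_minkQ_betaF (a T₀ : ℝ) (μ : Fin 4) (x : Fin 4 → ℝ) :
    pd μ (fun y => pd μ (fun z => minkQ (betaF a T₀ z)) y) x =
      2 * (a / T₀) ^ 2 * ((Pi.single μ 1 : Fin 4 → ℝ) 3 ^ 2
        - (Pi.single μ 1 : Fin 4 → ℝ) 0 ^ 2) := by
  set p := (Pi.single μ 1 : Fin 4 → ℝ) 3 with hp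
  set q := (Pi.single μ 1 : Fin 4 → ℝ) 0 with hq
  have e : (fun y => pd μ (fun z => minkQ (betaF a T₀ z)) y) = fun y =>
      (2 * (a / T₀) ^ 2 * p) * y 3 + (-(2 * (a / T₀) ^ 2 * q)) * y 0
        + 2 * (a / T₀) ^ 2 * p * (1 / a) := by
    funext y
    rw [pd_minkQ_betaF]
    ring
  rw [e, pd_linear]
  ring

/-- On the right Rindler wedge, □(1/(12β²)) = α²/(3(β²)²), where β² = Q(β) and
α² = −a²/T₀² is the constant squared thermal acceleration. -/
theorem dalembertian_of_thermal_psi_squared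
    (a T₀ : ℝ) (ha : 0 < a) (hT₀ : 0 < T₀) :
    ∀ x ∈ RRW a,
      dAlembert (fun y => 1 / (12 * minkQ (betaF a T₀ y))) x =
        (-(a ^ 2 / T₀ ^ 2)) / (3 * (minkQ (betaF a T₀ x)) ^ 2) := by
  intro x hx
  have h := (minkQ_betaF_pos ha hT₀ hx).ne'
  simp only [dAlembert, pd_pd_one_div_minkQ_betaF ha hT₀ hx, pd_pd_minkQ_betaF,
    Fin.sum_univ_four]
  simp only [pd_minkQ_betaF]
  simp [ηd]
  field_simp
  rw [minkQ_betaF]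
  field_simp
  ring
end
end
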